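/- In the linear Gaussian Bayesian inversion model, the Bayes risk E_θ E_{Φ|θ}[‖μ_post(Φ) - θ‖²] equals ‖Γ_post Lᵀ‖_F² + ‖Γ_post FᵀUᵀ‖_F², where LᵀL = Γ_pr⁻¹ and UᵀU = Γ_ε⁻¹. -/

import Mathlib

open Matrix MeasureTheory

/-- The multivariate Gaussian density with mean `m` and covariance `Σ` on `ℝ^n`. -/
noncomputable def gaussianPdf {n : ℕ} (m : Fin n → ℝ) (S : Matrix (Fin n) (Fin n) ℝ)
    (x : Fin n → ℝ) : ℝ :=
  (Real.sqrt ((2 * Real.pi) ^ n * S.det))⁻¹ *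
    Real.exp (-(1 / 2) * ((x - m) ⬝ᵥ S⁻¹ *ᵥ (x - m)))

open ProbabilityTheory

/-- The standard Gaussian measure on `Fin n → ℝ`, as a product measure. -/
noncomputable abbrev stdGaussianPi (n : ℕ) : Measure (Fin n → ℝ) :=
  Measure.pi fun _ => gaussianReal 0 1

theorem stdGaussianPi_eq_withDensity (n : ℕ) :
    stdGaussianPi n = (volume : Measure (Fin n → ℝ)).withDensity
      fun z => ENNReal.ofReal (∏ i, gaussianPDFReal 0 1 (z i)) := by
  refine Measure.pi_eq fun s hs => ?_
  have hnn : ∀ z : Fin n → ℝ, 0 ≤ ∏ i, gaussianPDFReal 0 1 (z i) :=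
    fun z => Finset.prod_nonneg fun i _ => gaussianPDFReal_nonneg _ _ _
  rw [withDensity_apply _ (MeasurableSet.univ_pi hs), volume_pi, Measure.restrict_pi_pi,
    ← ofReal_integral_eq_lintegral_ofReal _ (.of_forall hnn),
    integral_fintype_prod_eq_prod (fun _ x => gaussianPDFReal 0 1 x),
    ENNReal.ofReal_prod_of_nonneg
      fun i _ => integral_nonneg fun x => gaussianPDFReal_nonneg _ _ _]
  · exact Finset.prod_congr rfl fun i _ =>
      (gaussianReal_apply_eq_integral 0 one_ne_zero (s i)).symm
  · exact Integrable.fintype_prod_dep (f := fun _ x => gaussianPDFReal 0 1 x)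
      fun i => (integrable_gaussianPDFReal 0 1).restrict

theorem prod_gaussianPDFReal_eq {n : ℕ} (z : Fin n → ℝ) :
    ∏ i, gaussianPDFReal 0 1 (z i)
      = (Real.sqrt ((2 * Real.pi) ^ n))⁻¹ * Real.exp (-(1 / 2) * (z ⬝ᵥ z)) := by
  simp only [gaussianPDFReal, Finset.prod_mul_distrib, ← Real.exp_sum, Finset.prod_const,
    Finset.card_univ, Fintype.card_fin, NNReal.coe_one, mul_one, sub_zero]
  congr 1
  · rw [inv_pow, _root_.inv_inj, eq_comm, Real.sqrt_eq_iff_eq_sq (by positivity) (by positivity),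
      ← pow_mul, mul_comm n, pow_mul, Real.sq_sqrt (by positivity)]
  · congr 1
    rw [dotProduct, Finset.mul_sum]
    exact Finset.sum_congr rfl fun i _ => by ring

theorem integral_stdGaussianPi {n : ℕ} (g : (Fin n → ℝ) → ℝ) :
    ∫ z, g z ∂stdGaussianPi n = ∫ z, g z * gaussianPdf 0 1 z := by
  rw [stdGaussianPi_eq_withDensity, integral_withDensity_eq_integral_toReal_smul]
  · refine integral_congr_ae (.of_forall fun z => ?_)
    have hnn : 0 ≤ ∏ i, gaussianPDFReal 0 1 (z i) :=
      Finset.prod_nonneg fun i _ => gaussianPDFReal_nonneg _ _ _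
    simp only [ENNReal.toReal_ofReal hnn, smul_eq_mul]
    rw [prod_gaussianPDFReal_eq, gaussianPdf]
    simp [mul_comm]
  · exact (Finset.measurable_prod _ fun i _ =>
      (measurable_gaussianPDFReal 0 1).comp (measurable_pi_apply i)).ennreal_ofReal
  · exact .of_forall fun _ => ENNReal.ofReal_lt_top

theorem gaussianPdf_eq_of_whitening {n : ℕ} {m : Fin n → ℝ} {S L : Matrix (Fin n) (Fin n) ℝ}
    (hL : Lᵀ * L = S⁻¹) (x : Fin n → ℝ) :
    gaussianPdf m S x = |L.det| * gaussianPdf 0 1 (L *ᵥ (x - m)) := by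
  have hdet : |L.det| = (Real.sqrt S.det)⁻¹ := by
    have h := congrArg Matrix.det hL
    rw [det_mul, det_transpose, det_nonsing_inv, Ring.inverse_eq_inv', ← sq] at h
    rw [← Real.sqrt_sq_eq_abs, h, Real.sqrt_inv]
  have hquad : (x - m) ⬝ᵥ S⁻¹ *ᵥ (x - m) = (L *ᵥ (x - m)) ⬝ᵥ (L *ᵥ (x - m)) := by
    rw [← hL, ← mulVec_mulVec, dotProduct_mulVec, vecMul_transpose]
  simp only [gaussianPdf, hdet, hquad, det_one, mul_one, inv_one, one_mulVec, sub_zero]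
  rw [Real.sqrt_mul (by positivity), mul_inv]
  ring

theorem integral_comp_whitening_mul_gaussianPdf {n : ℕ} {m : Fin n → ℝ}
    {S L : Matrix (Fin n) (Fin n) ℝ} (hS : S.PosDef) (hL : Lᵀ * L = S⁻¹)
    {g : (Fin n → ℝ) → ℝ} (hg : Continuous g) :
    ∫ x, g (L *ᵥ (x - m)) * gaussianPdf m S x = ∫ z, g z ∂stdGaussianPi n := by
  have hdet : L.det ≠ 0 := by
    intro h0
    have h := congrArg Matrix.det hL
    rw [det_mul, h0, mul_zero] at h
    exact hS.inv.det_pos.ne h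
  have hcont : Continuous fun z : Fin n → ℝ => g z * gaussianPdf 0 1 z := by
    unfold gaussianPdf
    fun_prop
  simp only [gaussianPdf_eq_of_whitening hL]
  rw [integral_sub_right_eq_self
    (fun x => g (L *ᵥ x) * (|L.det| * gaussianPdf 0 1 (L *ᵥ x))) m, integral_stdGaussianPi]
  have hmap := integral_map (μ := volume) (φ := fun x : Fin n → ℝ => toLin' L x)
    (by fun_prop) (f := fun z => g z * gaussianPdf 0 1 z) hcont.aestronglyMeasurable
  rw [show (fun x : Fin n → ℝ => toLin' L x) = toLin' L from rfl,
    Real.map_matrix_volume_pi_eq_smul_volume_pi hdet, integral_smul_measure,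
    ENNReal.toReal_ofReal (abs_nonneg _), abs_inv, smul_eq_mul,
    inv_mul_eq_iff_eq_mul₀ (abs_ne_zero.mpr hdet), ← integral_const_mul] at hmap
  rw [hmap]
  refine integral_congr_ae (.of_forall fun x => ?_)
  simp only [toLin'_apply]
  ring

theorem memLp_affine_stdGaussianPi {n : ℕ} (a : ℝ) (v : Fin n → ℝ) :
    MemLp (fun z : Fin n → ℝ => a + v ⬝ᵥ z) 2 (stdGaussianPi n) := by
  refine (memLp_const a).add (memLp_finsetSum _ fun i _ => ?_)
  exact ((memLp_id_gaussianReal' 2 (by simp)).comp_measurePreserving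
    (measurePreserving_eval _ i)).const_mul (v i)

theorem integral_affine_sq_stdGaussianPi {n : ℕ} (a : ℝ) (v : Fin n → ℝ) :
    ∫ z, (a + v ⬝ᵥ z) ^ 2 ∂stdGaussianPi n = a ^ 2 + v ⬝ᵥ v := by
  have hcoord : ∀ i, Integrable (fun z : Fin n → ℝ => v i * z i) (stdGaussianPi n) := fun i =>
    (integrable_comp_eval (μ := fun _ : Fin n => gaussianReal 0 1) (f := fun x : ℝ => x)
      ((memLp_id_gaussianReal' 1 (by simp)).integrable le_rfl)).const_mul _
  have hmean : ∫ z, (a + v ⬝ᵥ z) ∂stdGaussianPi n = a := by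
    simp only [dotProduct]
    rw [integral_add (integrable_const _) (integrable_finsetSum _ fun i _ => hcoord i),
      integral_finsetSum _ fun i _ => hcoord i]
    have hzero : ∀ i, ∫ z : Fin n → ℝ, z i ∂stdGaussianPi n = 0 := fun i => by
      rw [integral_comp_eval (μ := fun _ : Fin n => gaussianReal 0 1) (i := i)
        (f := fun x : ℝ => x) (by fun_prop), integral_id_gaussianReal]
    simp [integral_const_mul, hzero]
  have hvar : Var[fun z => a + v ⬝ᵥ z; stdGaussianPi n] = v ⬝ᵥ v := by
    rw [variance_const_add (by fun_prop)]
    have h := variance_sum_pi (μ := fun _ : Fin n => gaussianReal 0 1)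
      (X := fun i x => v i * x) fun i => (memLp_id_gaussianReal' 2 (by simp)).const_mul (v i)
    convert h using 1
    · congr 1
      ext z
      simp [dotProduct]
    · refine Finset.sum_congr rfl fun i _ => ?_
      rw [variance_const_mul, variance_fun_id_gaussianReal, NNReal.coe_one, mul_one, sq]
  have h := variance_eq_sub (memLp_affine_stdGaussianPi a v)
  rw [hvar, hmean] at h
  simp only [Pi.pow_apply] at h
  linarith

theorem integral_const_add_affine_dotProduct_stdGaussianPi {k n : ℕ} (c : ℝ) (a : Fin k → ℝ)
    (M : Matrix (Fin k) (Fin n) ℝ) :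
    ∫ z, (c + (a + M *ᵥ z) ⬝ᵥ (a + M *ᵥ z)) ∂stdGaussianPi n
      = c + (a ⬝ᵥ a + trace (Mᵀ * M)) := by
  have hsq : ∀ z, (a + M *ᵥ z) ⬝ᵥ (a + M *ᵥ z) = ∑ i, (a i + M i ⬝ᵥ z) ^ 2 := fun z =>
    Finset.sum_congr rfl fun i _ => (sq _).symm
  have hint : ∀ i, Integrable (fun z => (a i + M i ⬝ᵥ z) ^ 2) (stdGaussianPi n) :=
    fun i => (memLp_affine_stdGaussianPi (a i) (M i)).integrable_sq
  simp only [hsq]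
  rw [integral_add (integrable_const _) (integrable_finsetSum _ fun i _ => hint i),
    integral_finsetSum _ fun i _ => hint i]
  simp only [integral_affine_sq_stdGaussianPi, Finset.sum_add_distrib, integral_const,
    probReal_univ, one_smul]
  rw [trace_mul_comm]
  simp [dotProduct, trace, mul_apply, sq]

theorem integral_affine_dotProduct_mul_gaussianPdf {k n : ℕ} {m : Fin n → ℝ}
    {S L : Matrix (Fin n) (Fin n) ℝ} (hS : S.PosDef) (hL : Lᵀ * L = S⁻¹) (c : ℝ)
    (a : Fin k → ℝ) (M : Matrix (Fin k) (Fin n) ℝ) :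
    ∫ x, (c + (a + M *ᵥ (L *ᵥ (x - m))) ⬝ᵥ (a + M *ᵥ (L *ᵥ (x - m)))) * gaussianPdf m S x
      = c + (a ⬝ᵥ a + trace (Mᵀ * M)) := by
  rw [← integral_const_add_affine_dotProduct_stdGaussianPi]
  exact integral_comp_whitening_mul_gaussianPdf hS hL
    (g := fun z => c + (a + M *ᵥ z) ⬝ᵥ (a + M *ᵥ z)) (by fun_prop)

/-- Bayes risk of the posterior mean in the linear Gaussian model:
`E_θ E_{Φ|θ} ‖μ_post(Φ) - θ‖² = ‖Γpost Lᵀ‖_F² + ‖Γpost FᵀUᵀ‖_F²`,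
where `θ ~ N(μpr, Γpr)`, `Φ = Fθ + ε`, `ε ~ N(0, Γε)`, `LᵀL = Γpr⁻¹`, `UᵀU = Γε⁻¹`. -/
theorem bayes_risk_closed_form (dd Np : ℕ) (F : Matrix (Fin dd) (Fin Np) ℝ)
    (μpr : Fin Np → ℝ) (Γpr L : Matrix (Fin Np) (Fin Np) ℝ) (hpr : Γpr.PosDef)
    (Γε U : Matrix (Fin dd) (Fin dd) ℝ) (hε : Γε.PosDef)
    (hLL : Lᵀ * L = Γpr⁻¹) (hUU : Uᵀ * U = Γε⁻¹)
    (Γpost : Matrix (Fin Np) (Fin Np) ℝ)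
    (hpost : Γpost = (Fᵀ * Γε⁻¹ * F + Γpr⁻¹)⁻¹)
    (μpost : (Fin dd → ℝ) → (Fin Np → ℝ))
    (hμpost : ∀ Φ, μpost Φ = Γpost *ᵥ (Fᵀ *ᵥ (Γε⁻¹ *ᵥ Φ) + Γpr⁻¹ *ᵥ μpr)) :
    (∫ θ : Fin Np → ℝ,
        (∫ ε : Fin dd → ℝ,
            ((μpost (F *ᵥ θ + ε) - θ) ⬝ᵥ (μpost (F *ᵥ θ + ε) - θ)) *
              gaussianPdf 0 Γε ε) *
          gaussianPdf μpr Γpr θ)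
      = Matrix.trace ((Γpost * Lᵀ)ᵀ * (Γpost * Lᵀ))
        + Matrix.trace ((Γpost * Fᵀ * Uᵀ)ᵀ * (Γpost * Fᵀ * Uᵀ)) := by
  have hunit : IsUnit (Fᵀ * Γε⁻¹ * F + Γpr⁻¹).det := by
    have hsemi : (Fᵀ * Γε⁻¹ * F).PosSemidef := by
      simpa using hε.inv.posSemidef.conjTranspose_mul_mul_same F
    exact (hpr.inv.posSemidef_add hsemi).det_pos.ne'.isUnit
  have hone : Γpost * (Fᵀ * Γε⁻¹ * F + Γpr⁻¹) = 1 := hpost ▸ nonsing_inv_mul _ hunit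
  have hres : ∀ θ ε, μpost (F *ᵥ θ + ε) - θ
      = (0 + (-(Γpost * Lᵀ)) *ᵥ (L *ᵥ (θ - μpr)))
        + (Γpost * Fᵀ * Uᵀ) *ᵥ (U *ᵥ (ε - 0)) := fun θ ε => by
    have hθ : θ = Γpost *ᵥ ((Fᵀ * Γε⁻¹ * F) *ᵥ θ + Γpr⁻¹ *ᵥ θ) := by
      rw [← add_mulVec, mulVec_mulVec, hone, one_mulVec]
    rw [hμpost]
    nth_rewrite 2 [hθ]
    simp only [← hLL, ← hUU, neg_mulVec, Matrix.neg_mul, mulVec_add, mulVec_sub, mulVec_mulVec, sub_zero,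
      zero_add, Matrix.mul_assoc]
    abel
  have hinner : ∀ θ, (∫ ε, ((μpost (F *ᵥ θ + ε) - θ) ⬝ᵥ (μpost (F *ᵥ θ + ε) - θ)) *
        gaussianPdf 0 Γε ε)
      = trace ((Γpost * Fᵀ * Uᵀ)ᵀ * (Γpost * Fᵀ * Uᵀ))
        + (0 + (-(Γpost * Lᵀ)) *ᵥ (L *ᵥ (θ - μpr)))
          ⬝ᵥ (0 + (-(Γpost * Lᵀ)) *ᵥ (L *ᵥ (θ - μpr))) := fun θ => by
    have h := integral_affine_dotProduct_mul_gaussianPdf (m := 0) hε hUU 0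
      (0 + (-(Γpost * Lᵀ)) *ᵥ (L *ᵥ (θ - μpr))) (Γpost * Fᵀ * Uᵀ)
    simp only [← hres, zero_add (_ ⬝ᵥ _)] at h
    rw [h]
    ring
  simp only [hinner]
  rw [integral_affine_dotProduct_mul_gaussianPdf hpr hLL, transpose_neg, Matrix.neg_mul,
    Matrix.mul_neg, neg_neg, dotProduct_zero, zero_add, add_comm]
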